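/- Let m ≥ 2 and n ≥ 1, let A be an mth-order n-dimensional strictly semi-positive real tensor, let q ∈ ℝⁿ, a ∈ ℝⁿ with a ≥ 0, b ∈ ℝⁿ with b > 0, and let δ ∈ (0,1). Define H(x,y,t) ∈ ℝ²ⁿ by H(x,y,t) = (x₁y₁ − t a₁, …, xₙyₙ − t aₙ, y − (1−t)(A x^{m-1} + q) − t b). Then the set { (x,y,t) ∈ ℝⁿ × ℝⁿ × ℝ : x ≥ 0, y ≥ 0, 0 ≤ t ≤ 1−δ, H(x,y,t) = 0 } is bounded. -/

import Mathlib

open Finset Filter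

/-- `A x^{m-1}`: the vector whose `i`-th entry is the sum over all tuples of the
remaining `r = m-1` indices of the tensor entry times the product of components of `x`. -/
noncomputable def tApply {n r : ℕ} (A : Fin n → (Fin r → Fin n) → ℝ) (x : Fin n → ℝ) :
    Fin n → ℝ :=
  fun i => ∑ j : Fin r → Fin n, A i j * ∏ k, x (j k)

/-- A tensor is strictly semi-positive if for every nonzero nonnegative `x` there is an
index `i` with `x i > 0` and `(A x^{m-1}) i > 0`. -/
def StrictlySemiPositive {n r : ℕ} (A : Fin n → (Fin r → Fin n) → ℝ) : Prop :=
  ∀ x : Fin n → ℝ, (∀ i, 0 ≤ x i) → x ≠ 0 → ∃ i, 0 < x i ∧ 0 < tApply A x i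

/-- `f` is a P-function on the nonnegative orthant: for distinct nonnegative `x, y`,
`max_i (x_i - y_i)(f_i(x) - f_i(y)) > 0`. -/
def PFunctionOn {n : ℕ} (f : (Fin n → ℝ) → Fin n → ℝ) : Prop :=
  ∀ x y : Fin n → ℝ, (∀ i, 0 ≤ x i) → (∀ i, 0 ≤ y i) → x ≠ y →
    ∃ i, 0 < (x i - y i) * (f x i - f y i)

/-- A tensor is strong strictly semi-positive if `x ↦ A x^{m-1} + q` is a P-function
on the nonnegative orthant for every `q`. -/
def StrongStrictlySemiPositive {n r : ℕ} (A : Fin n → (Fin r → Fin n) → ℝ) : Prop :=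
  ∀ q : Fin n → ℝ, PFunctionOn (fun x i => tApply A x i + q i)

/-- The solution set of the tensor complementarity problem TCP(A, q). -/
noncomputable def TCPSol {n r : ℕ} (A : Fin n → (Fin r → Fin n) → ℝ) (q : Fin n → ℝ) :
    Set (Fin n → ℝ) :=
  {x | (∀ i, 0 ≤ x i) ∧ (∀ i, 0 ≤ tApply A x i + q i) ∧
    ∑ i, x i * (tApply A x i + q i) = 0}

theorem continuous_tApply {n r : ℕ} (A : Fin n → (Fin r → Fin n) → ℝ) :
    Continuous (tApply A) := by
  unfold tApply
  fun_prop

theorem tApply_smul {n r : ℕ} (A : Fin n → (Fin r → Fin n) → ℝ) (s : ℝ) (x : Fin n → ℝ)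
    (i : Fin n) : tApply A (s • x) i = s ^ r * tApply A x i := by
  simp only [tApply, Pi.smul_apply, smul_eq_mul, Finset.prod_mul_distrib, Finset.prod_const,
    Finset.card_univ, Fintype.card_fin, Finset.mul_sum]
  exact Finset.sum_congr rfl fun j _ => by ring

/-- On the nonnegative part of the unit sphere, the total positive part of `x_i (A x^{m-1})_i` is
bounded away from zero. -/
theorem StrictlySemiPositive.exists_pos_le_sum {n r : ℕ} {A : Fin n → (Fin r → Fin n) → ℝ}
    (hA : StrictlySemiPositive A) :
    ∃ c : ℝ, 0 < c ∧ ∀ x : Fin n → ℝ, (∀ i, 0 ≤ x i) → ‖x‖ = 1 →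
      c ≤ ∑ i, max 0 (x i * tApply A x i) := by
  have hcont : Continuous fun x : Fin n → ℝ => ∑ i, max 0 (x i * tApply A x i) := by
    have := continuous_tApply A
    fun_prop
  have hK : IsCompact (Metric.sphere (0 : Fin n → ℝ) 1 ∩ Set.Ici 0) :=
    (isCompact_sphere 0 1).inter_right isClosed_Ici
  obtain ⟨c, hc, h⟩ := hK.exists_forall_le' (a := 0) hcont.continuousOn (by
    rintro x ⟨hx1, hx0⟩
    have hx : x ≠ 0 := by
      rintro rfl
      simp at hx1
    obtain ⟨i, hi, hi'⟩ := hA x hx0 hx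
    exact Finset.sum_pos' (fun _ _ => le_max_left _ _)
      ⟨i, Finset.mem_univ i, lt_max_of_lt_right (mul_pos hi hi')⟩)
  exact ⟨c, hc, fun x hx0 hx1 => h x ⟨by simpa using hx1, hx0⟩⟩

/-- A nonnegative `x` for which each `x_i (A x^{m-1})_i` grows at most linearly in `x_i` is
bounded, with a bound depending only on `A` and the growth coefficients. -/
theorem StrictlySemiPositive.exists_norm_le {n r : ℕ} (hr : r ≠ 0)
    {A : Fin n → (Fin r → Fin n) → ℝ} (hA : StrictlySemiPositive A) (u v : Fin n → ℝ)
    (hu : ∀ i, 0 ≤ u i) (hv : ∀ i, 0 ≤ v i) :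
    ∃ R : ℝ, ∀ x : Fin n → ℝ, (∀ i, 0 ≤ x i) →
      (∀ i, x i * tApply A x i ≤ u i + v i * x i) → ‖x‖ ≤ R := by
  obtain ⟨c, hc, h⟩ := hA.exists_pos_le_sum
  refine ⟨max 1 ((∑ i, (u i + v i)) / c), fun x hx0 hx => ?_⟩
  rcases le_or_gt ‖x‖ 1 with h1 | h1
  · exact le_max_of_le_left h1
  refine le_max_of_le_right ?_
  have hpos : 0 < ‖x‖ := one_pos.trans h1
  set w : Fin n → ℝ := ‖x‖⁻¹ • x with hw
  have hxw : x = ‖x‖ • w := by rw [hw, smul_inv_smul₀ hpos.ne']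
  have hw0 : ∀ i, 0 ≤ w i := fun i => mul_nonneg (inv_nonneg.2 hpos.le) (hx0 i)
  have hw1 : ‖w‖ = 1 := by
    rw [hw, norm_smul, norm_inv, norm_norm, inv_mul_cancel₀ hpos.ne']
  have key : ∀ i, ‖x‖ * max 0 (w i * tApply A w i) ≤ u i + v i := by
    intro i
    have hxi : x i ≤ ‖x‖ := (le_abs_self _).trans (norm_le_pi_norm x i)
    have hbound : x i * tApply A x i ≤ ‖x‖ * (u i + v i) :=
      (hx i).trans (by nlinarith [hu i, hv i, mul_le_mul_of_nonneg_left hxi (hv i)])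
    have hscale : x i * tApply A x i = ‖x‖ * (‖x‖ ^ r * (w i * tApply A w i)) := by
      have h2 : tApply A x i = ‖x‖ ^ r * tApply A w i := by
        rw [← tApply_smul, ← hxw]
      have h3 : x i = ‖x‖ * w i := congrFun hxw i
      rw [h2]
      nth_rewrite 1 [h3]
      ring
    rw [hscale] at hbound
    have hle := le_of_mul_le_mul_left hbound hpos
    rcases le_total (w i * tApply A w i) 0 with h0 | h0
    · rw [max_eq_left h0, mul_zero]
      exact add_nonneg (hu i) (hv i)
    · rw [max_eq_right h0]
      exact (mul_le_mul_of_nonneg_right (le_self_pow₀ h1.le hr) h0).trans hle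
  rw [le_div_iff₀ hc]
  calc ‖x‖ * c ≤ ‖x‖ * ∑ i, max 0 (w i * tApply A w i) :=
        mul_le_mul_of_nonneg_left (h w hw0 hw1) hpos.le
    _ = ∑ i, ‖x‖ * max 0 (w i * tApply A w i) := Finset.mul_sum _ _ _
    _ ≤ ∑ i, (u i + v i) := Finset.sum_le_sum fun i _ => key i

theorem homotopy_solution_set_bounded
    (m n : ℕ) (hm : 2 ≤ m) (hn : 1 ≤ n)
    (A : Fin n → (Fin (m - 1) → Fin n) → ℝ)
    (hA : StrictlySemiPositive A)
    (q a b : Fin n → ℝ) (ha : ∀ i, 0 ≤ a i) (hb : ∀ i, 0 < b i)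
    (δ : ℝ) (hδ : δ ∈ Set.Ioo (0 : ℝ) 1) :
    Bornology.IsBounded {p : (Fin n → ℝ) × (Fin n → ℝ) × ℝ |
      (∀ i, 0 ≤ p.1 i) ∧ (∀ i, 0 ≤ p.2.1 i) ∧ 0 ≤ p.2.2 ∧ p.2.2 ≤ 1 - δ ∧
      (∀ i, p.1 i * p.2.1 i = p.2.2 * a i) ∧
      (∀ i, p.2.1 i = (1 - p.2.2) * (tApply A p.1 i + q i) + p.2.2 * b i)} := by
  obtain ⟨hδ0, -⟩ := hδ
  obtain ⟨R, hR⟩ := hA.exists_norm_le (by omega) (fun i => a i / δ) (fun i => |q i|)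
    (fun i => div_nonneg (ha i) hδ0.le) (fun i => abs_nonneg _)
  have hcont : Continuous fun p : (Fin n → ℝ) × ℝ =>
      ((p.1, (fun i => (1 - p.2) * (tApply A p.1 i + q i) + p.2 * b i), p.2) :
        (Fin n → ℝ) × (Fin n → ℝ) × ℝ) := by
    have := continuous_tApply A
    fun_prop
  refine (((isCompact_closedBall (0 : Fin n → ℝ) R).prod
    (isCompact_Icc (a := (0 : ℝ)) (b := 1 - δ))).image hcont).isBounded.subset ?_
  rintro ⟨x, y, t⟩ ⟨hx, -, ht0, ht1, hxy, hy⟩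
  dsimp only at hx ht0 ht1 hxy hy
  refine ⟨(x, t), ⟨mem_closedBall_zero_iff.2 (hR x hx fun i => ?_), ht0, ht1⟩,
    Prod.ext rfl (Prod.ext (funext fun i => (hy i).symm) rfl)⟩
  have hδt : δ ≤ 1 - t := by linarith
  have hpos : 0 < 1 - t := hδ0.trans_le hδt
  have heq : (1 - t) * (x i * (tApply A x i + q i)) = t * a i - t * b i * x i := by
    rw [← hxy i, hy i]
    ring
  have hle : (1 - t) * (x i * (tApply A x i + q i)) ≤ a i := by
    have h1 : 0 ≤ t * b i * x i := mul_nonneg (mul_nonneg ht0 (hb i).le) (hx i)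
    have h2 : t * a i ≤ a i := mul_le_of_le_one_left (ha i) (by linarith)
    linarith
  have hdiv : x i * (tApply A x i + q i) ≤ a i / δ := by
    refine ((le_div_iff₀' hpos).2 hle).trans ?_
    exact div_le_div_of_nonneg_left (ha i) hδ0 hδt
  have hq : -q i * x i ≤ |q i| * x i := mul_le_mul_of_nonneg_right (neg_le_abs _) (hx i)
  linarith
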